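/- arXiv:2507.11461 — 6 statements merged into one kernel-verified Lean document; each statement's English description precedes it below -/
import Mathlib

section
/- Let m, n ≥ 1, let y ∈ ℝ^m have nonnegative entries, and let A ∈ ℝ^{m×n} have nonnegative entries with every row nonzero (so that Ax has all positive entries whenever x has all positive entries). Define f(x) = KL(y, Ax) for x in the open positive orthant ℝⁿ_{>0}, and let h be Burg's entropy. Then for every L ≥ ‖y‖₁ = ∑_{i=1}^m |y_i|, the function x ↦ L·h(x) − f(x) is convex on ℝⁿ_{>0}. -/
/-- A function with an affine minorant, exact at `z`, for every `z` in a convex set is convex. -/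
theorem convexOn_of_affine_minorants {n : ℕ} {s : Set (Fin n → ℝ)} (hs : Convex ℝ s)
    {f : (Fin n → ℝ) → ℝ}
    (h : ∀ z ∈ s, ∃ g : Fin n → ℝ, ∀ x ∈ s, f z + ∑ j, g j * (x j - z j) ≤ f x) :
    ConvexOn ℝ s f := by
  refine ⟨hs, fun x hx w hw a b ha hb hab => ?_⟩
  obtain ⟨g, hg⟩ := h _ (hs hx hw ha hb hab)
  set z := a • x + b • w with hz
  have hzero : a * ∑ j, g j * (x j - z j) + b * ∑ j, g j * (w j - z j) = 0 := by
    rw [Finset.mul_sum, Finset.mul_sum, ← Finset.sum_add_distrib]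
    refine Finset.sum_eq_zero fun j _ => ?_
    simp only [hz, Pi.add_apply, Pi.smul_apply, smul_eq_mul]
    linear_combination (-g j * (a * x j + b * w j)) * hab
  have h₁ := mul_le_mul_of_nonneg_left (hg x hx) ha
  have h₂ := mul_le_mul_of_nonneg_left (hg w hw) hb
  have h₃ : a * f z + b * f z = f z := by rw [← add_mul, hab, one_mul]
  simp only [smul_eq_mul]
  linarith

theorem convex_pos_orthant (n : ℕ) : Convex ℝ {x : Fin n → ℝ | ∀ j, 0 < x j} := by
  intro x hx w hw a b ha hb hab j
  exact convex_Ioi (0 : ℝ) (hx j) (hw j) ha hb hab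

theorem dotProduct_pos_of_nonneg_of_ne_zero {n : ℕ} {a x : Fin n → ℝ} (ha : ∀ j, 0 ≤ a j)
    (ha0 : a ≠ 0) (hx : ∀ j, 0 < x j) : 0 < a ⬝ᵥ x := by
  obtain ⟨k, hk⟩ := Function.ne_iff.mp ha0
  exact Finset.sum_pos' (fun j _ => mul_nonneg (ha j) (hx j).le)
    ⟨k, Finset.mem_univ k, mul_pos ((ha k).lt_of_ne' hk) (hx k)⟩

theorem convexOn_neg_sum_log (n : ℕ) :
    ConvexOn ℝ {x : Fin n → ℝ | ∀ j, 0 < x j} (fun x => -∑ j, Real.log (x j)) := by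
  refine convexOn_of_affine_minorants (convex_pos_orthant n) fun z hz =>
    ⟨fun j => -(z j)⁻¹, fun x hx => ?_⟩
  rw [← Finset.sum_neg_distrib, ← Finset.sum_neg_distrib, ← Finset.sum_add_distrib]
  refine Finset.sum_le_sum fun j _ => ?_
  have h := Real.log_le_sub_one_of_pos (div_pos (hx j) (hz j))
  rw [Real.log_div (hx j).ne' (hz j).ne'] at h
  have hz' := (hz j).ne'
  have : -(z j)⁻¹ * (x j - z j) = -(x j / z j - 1) := by field_simp
  linarith

/-- Burg's entropy compensates the concavity of the logarithm of a nonnegative linear form. -/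
theorem convexOn_log_dotProduct_sub_sum_log {n : ℕ} {a : Fin n → ℝ} (ha : ∀ j, 0 ≤ a j)
    (ha0 : a ≠ 0) :
    ConvexOn ℝ {x : Fin n → ℝ | ∀ j, 0 < x j}
      (fun x => Real.log (a ⬝ᵥ x) + -∑ j, Real.log (x j)) := by
  refine convexOn_of_affine_minorants (convex_pos_orthant n) fun z hz => ?_
  have hS := dotProduct_pos_of_nonneg_of_ne_zero ha ha0 hz
  set S := a ⬝ᵥ z with hSdef
  refine ⟨fun j => (a j * z j / S - 1) / z j, fun x hx => ?_⟩
  have hT := dotProduct_pos_of_nonneg_of_ne_zero ha ha0 hx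
  have hp0 : ∀ j, 0 ≤ a j * z j / S := fun j =>
    div_nonneg (mul_nonneg (ha j) (hz j).le) hS.le
  have hp1 : ∑ j, a j * z j / S = 1 := by
    rw [← Finset.sum_div]
    exact div_self hS.ne'
  have hpu : ∑ j, a j * z j / S * (x j / z j) = (a ⬝ᵥ x) / S := by
    rw [dotProduct, Finset.sum_div]
    refine Finset.sum_congr rfl fun j _ => ?_
    have := (hz j).ne'
    field_simp
  have hJ := strictConcaveOn_log_Ioi.concaveOn.le_map_sum (t := Finset.univ)
    (w := fun j => a j * z j / S) (p := fun j => x j / z j) (fun j _ => hp0 j) hp1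
    (fun j _ => div_pos (hx j) (hz j))
  simp only [smul_eq_mul] at hJ
  rw [hpu, Real.log_div hT.ne' hS.ne'] at hJ
  have hterm : ∀ j, Real.log (x j) - Real.log (z j) + (a j * z j / S - 1) / z j * (x j - z j)
      ≤ a j * z j / S * Real.log (x j / z j) := fun j => by
    have hle : a j * z j / S ≤ 1 :=
      hp1 ▸ Finset.single_le_sum (fun i _ => hp0 i) (Finset.mem_univ j)
    have h := mul_le_mul_of_nonneg_left
      (Real.log_le_sub_one_of_pos (div_pos (hx j) (hz j))) (sub_nonneg.mpr hle)
    have hz' := (hz j).ne'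
    have he : (a j * z j / S - 1) / z j * (x j - z j)
        = (a j * z j / S - 1) * (x j / z j - 1) := by
      field_simp
    rw [he, ← Real.log_div (hx j).ne' hz']
    linarith
  have hsum := Finset.sum_le_sum fun j (_ : j ∈ Finset.univ) => hterm j
  rw [Finset.sum_add_distrib, Finset.sum_sub_distrib] at hsum
  linarith

/-- For `L ≥ ‖y‖₁`, the function `x ↦ L·h(x) − KL(y, Ax)` is convex on the
open positive orthant, where `h` is Burg's entropy. -/
theorem stmt0 (m n : ℕ) (hm : 1 ≤ m) (hn : 1 ≤ n)
    (y : Fin m → ℝ) (hy : ∀ i, 0 ≤ y i)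
    (A : Matrix (Fin m) (Fin n) ℝ)
    (hA : ∀ i j, 0 ≤ A i j) (hrow : ∀ i, A i ≠ 0)
    (L : ℝ) (hL : ∑ i, |y i| ≤ L) :
    ConvexOn ℝ {x : Fin n → ℝ | ∀ j, 0 < x j}
      (fun x => L * (-∑ j, Real.log (x j)) -
        ∑ i, (y i * Real.log (y i / A.mulVec x i) + A.mulVec x i - y i)) := by
  simp only [abs_of_nonneg (hy _)] at hL
  have hs := convex_pos_orthant n
  have hrows : ConvexOn ℝ {x : Fin n → ℝ | ∀ j, 0 < x j} (fun x => ∑ i,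
      (y i * (Real.log (A i ⬝ᵥ x) + -∑ j, Real.log (x j))
        + (-(A i ⬝ᵥ x) + (y i - y i * Real.log (y i))))) := by
    refine ⟨hs, fun x hx w hw a b ha hb hab => ?_⟩
    simp only [smul_eq_mul]
    rw [Finset.mul_sum, Finset.mul_sum, ← Finset.sum_add_distrib]
    refine Finset.sum_le_sum fun i _ => ?_
    have h := mul_le_mul_of_nonneg_left
      ((convexOn_log_dotProduct_sub_sum_log (hA i) (hrow i)).2 hx hw ha hb hab) (hy i)
    simp only [smul_eq_mul] at h
    have hlin : A i ⬝ᵥ (a • x + b • w) = a * (A i ⬝ᵥ x) + b * (A i ⬝ᵥ w) := by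
      simp [dotProduct_add, dotProduct_smul]
    have hc : a * (y i - y i * Real.log (y i)) + b * (y i - y i * Real.log (y i))
        = y i - y i * Real.log (y i) := by rw [← add_mul, hab, one_mul]
    linarith
  refine (((convexOn_neg_sum_log n).smul (sub_nonneg.mpr hL)).add hrows).congr fun x hx => ?_
  have hterm : ∀ i, y i * (Real.log (A i ⬝ᵥ x) + -∑ j, Real.log (x j))
        + (-(A i ⬝ᵥ x) + (y i - y i * Real.log (y i)))
      = y i * (-∑ j, Real.log (x j))
        - (y i * Real.log (y i / A.mulVec x i) + A.mulVec x i - y i) := fun i => by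
    have hpos := dotProduct_pos_of_nonneg_of_ne_zero (hA i) (hrow i) hx
    change _ = _ - (y i * Real.log (y i / (A i ⬝ᵥ x)) + A i ⬝ᵥ x - y i)
    rcases eq_or_ne (y i) 0 with h0 | h0
    · simp [h0]
    · rw [Real.log_div h0 hpos.ne']
      ring
  simp only [Pi.add_apply, smul_eq_mul, hterm]
  rw [Finset.sum_sub_distrib, ← Finset.sum_mul]
  ring
end

section
/- Let a > 0 and let x ∈ ℝⁿ have all positive coordinates. Then the function u ↦ D_h(u, x), where D_h is the Bregman divergence of Burg's entropy, attains a unique minimizer over the set {u ∈ ℝⁿ : 0 < u_i ≤ a for all i}, and this minimizer is the point u* with u*_i = min(x_i, a) for each i, i.e., the Euclidean projection of x onto the cube [0,a]^n. -/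
/-- On `(0, a]`, the clamp `min x a` strictly minimizes the one-dimensional Burg divergence. -/
theorem burg_divergence_min_lt {a x u : ℝ} (ha : 0 < a) (hx : 0 < x) (hu : 0 < u)
    (hua : u ≤ a) (hne : u ≠ min x a) :
    -Real.log (min x a) + Real.log x + (min x a - x) / x
      < -Real.log u + Real.log x + (u - x) / x := by
  have hm : 0 < min x a := lt_min hx ha
  have hlog := Real.log_lt_sub_one_of_pos (div_pos hu hm) (by rwa [ne_eq, div_eq_one_iff_eq hm.ne'])
  rw [Real.log_div hu.ne' hm.ne'] at hlog
  have hslope : u / min x a - 1 ≤ (u - x) / x - (min x a - x) / x := by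
    rcases le_total x a with h | h
    · rw [min_eq_left h]
      field_simp
      linarith
    · rw [min_eq_right h, div_sub_one ha.ne', ← sub_div, div_le_div_iff₀ ha hx]
      nlinarith [mul_nonneg (sub_nonneg.2 hua) (sub_nonneg.2 h)]
  linarith

theorem burg_divergence_min_le {a x u : ℝ} (ha : 0 < a) (hx : 0 < x) (hu : 0 < u)
    (hua : u ≤ a) :
    -Real.log (min x a) + Real.log x + (min x a - x) / x
      ≤ -Real.log u + Real.log x + (u - x) / x := by
  by_cases h : u = min x a
  · rw [h]
  · exact (burg_divergence_min_lt ha hx hu hua h).le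


/-- the componentwise clamp `u*_i = min (x_i) a` is the unique minimizer of
`u ↦ D_h(u,x)` (Burg Bregman divergence) over `{u : ∀ i, 0 < u_i ≤ a}`. -/
theorem stmt3 {n : ℕ} (a : ℝ) (ha : 0 < a) (x : Fin n → ℝ) (hx : ∀ i, 0 < x i) :
    ((fun i => min (x i) a) ∈ {u : Fin n → ℝ | ∀ i, 0 < u i ∧ u i ≤ a}) ∧
    (∀ u ∈ {u : Fin n → ℝ | ∀ i, 0 < u i ∧ u i ≤ a},
      (∑ i, (-Real.log (min (x i) a) + Real.log (x i) + (min (x i) a - x i) / x i))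
        ≤ ∑ i, (-Real.log (u i) + Real.log (x i) + (u i - x i) / x i)) ∧
    (∀ u ∈ {u : Fin n → ℝ | ∀ i, 0 < u i ∧ u i ≤ a},
      (∑ i, (-Real.log (u i) + Real.log (x i) + (u i - x i) / x i))
        = (∑ i, (-Real.log (min (x i) a) + Real.log (x i) + (min (x i) a - x i) / x i))
        → u = fun i => min (x i) a) := by
  refine ⟨fun i => ⟨lt_min (hx i) ha, min_le_right _ _⟩, fun u hu => ?_, fun u hu heq => ?_⟩
  · exact Finset.sum_le_sum fun i _ => burg_divergence_min_le ha (hx i) (hu i).1 (hu i).2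
  · funext i
    by_contra hne
    refine (Finset.sum_lt_sum (fun j _ => burg_divergence_min_le ha (hx j) (hu j).1 (hu j).2)
      ⟨i, Finset.mem_univ i, ?_⟩).ne' heq
    exact burg_divergence_min_lt ha (hx i) (hu i).1 (hu i).2 hne
end

section
/- Let a > 0, τ > 0, let x ∈ ℝⁿ have all positive coordinates, and let g ∈ ℝⁿ be arbitrary. Then the function ψ(u) = ⟨u − x, g⟩ + (1/τ)·D_h(u, x), where D_h is the Bregman divergence of Burg's entropy, attains its infimum over the set {u ∈ ℝⁿ : 0 < u_i ≤ a for all i} at a unique point u*, and every coordinate of u* is strictly positive. -/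
/-- On `(0, a]`, the function `t ↦ c * t - log t` has a strict global minimizer. -/
lemma exists_strict_min_mul_sub_log (a c : ℝ) (ha : 0 < a) :
    ∃ t, (0 < t ∧ t ≤ a) ∧
      ∀ s, 0 < s → s ≤ a → s ≠ t → c * t - Real.log t < c * s - Real.log s := by
  obtain ⟨t, ht, hta, hmin⟩ : ∃ t, 0 < t ∧ t ≤ a ∧ ∀ s, s ≤ a → 0 ≤ (s - t) * (c - 1 / t) := by
    rcases le_or_gt c (1 / a) with h | h
    · exact ⟨a, ha, le_rfl, fun s hs =>
        mul_nonneg_of_nonpos_of_nonpos (sub_nonpos.2 hs) (sub_nonpos.2 h)⟩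
    · have hc : 0 < c := (one_div_pos.2 ha).trans h
      exact ⟨1 / c, one_div_pos.2 hc, ((one_div_lt ha hc).1 h).le, fun s _ => by simp⟩
  refine ⟨t, ⟨ht, hta⟩, fun s hs hsa hst => ?_⟩
  have hlog := Real.log_lt_sub_one_of_pos (div_pos hs ht) (by rwa [Ne, div_eq_one_iff_eq ht.ne'])
  rw [Real.log_div hs.ne' ht.ne'] at hlog
  have hid : (s - t) * (c - 1 / t) = c * s - c * t - (s / t - 1) := by
    field_simp
  linarith [hmin s hsa]

/-- well-posedness of the projected Mirror Descent subproblem with box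
constraint: the objective attains its infimum over `{u : ∀ i, 0 < u_i ≤ a}` at a unique
point, all of whose coordinates are strictly positive. -/
theorem stmt10 {n : ℕ} (a τ : ℝ) (ha : 0 < a) (hτ : 0 < τ)
    (x g : Fin n → ℝ) (hx : ∀ i, 0 < x i) :
    let ψ : (Fin n → ℝ) → ℝ := fun u =>
      (∑ i, (u i - x i) * g i) +
        (1 / τ) * ∑ i, (-Real.log (u i) + Real.log (x i) + (u i - x i) / x i)
    ∃ ustar ∈ {u : Fin n → ℝ | ∀ i, 0 < u i ∧ u i ≤ a},
      (∀ u ∈ {u : Fin n → ℝ | ∀ i, 0 < u i ∧ u i ≤ a}, ψ ustar ≤ ψ u) ∧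
      (∀ u ∈ {u : Fin n → ℝ | ∀ i, 0 < u i ∧ u i ≤ a}, ψ u = ψ ustar → u = ustar) ∧
      (∀ i, 0 < ustar i) := by
  intro ψ
  choose v hv hmin using fun i => exists_strict_min_mul_sub_log a (τ * g i + 1 / x i) ha
  have hψ : ∀ u, ψ u = (1 / τ) * ∑ i, ((τ * g i + 1 / x i) * u i - Real.log (u i)) +
      ∑ i, ((1 / τ) * (Real.log (x i) - 1) - x i * g i) := by
    intro u
    simp only [ψ, Finset.mul_sum, ← Finset.sum_add_distrib]
    refine Finset.sum_congr rfl fun i _ => ?_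
    have := (hx i).ne'
    field_simp
    ring
  have hlt : ∀ u : Fin n → ℝ, (∀ i, 0 < u i ∧ u i ≤ a) → u ≠ v → ψ v < ψ u := by
    intro u hu huv
    obtain ⟨j, hj⟩ := Function.ne_iff.1 huv
    rw [hψ, hψ]
    gcongr ?_ + _
    refine mul_lt_mul_of_pos_left (Finset.sum_lt_sum (fun i _ => ?_)
      ⟨j, Finset.mem_univ j, hmin j _ (hu j).1 (hu j).2 hj⟩) (one_div_pos.2 hτ)
    by_cases h : u i = v i
    · rw [h]
    · exact (hmin i _ (hu i).1 (hu i).2 h).le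
  refine ⟨v, hv, fun u hu => ?_, fun u hu h => ?_, fun i => (hv i).1⟩
  · by_cases huv : u = v
    · rw [huv]
    · exact (hlt u hu huv).le
  · by_contra huv
    exact (hlt u hu huv).ne' h
end

section
/- Let a > 0, τ > 0, let x ∈ ℝⁿ have all positive coordinates, and let g ∈ ℝⁿ satisfy 1/x_i + τ·g_i > 0 for every i. Then the unique minimizer over {u ∈ ℝⁿ : 0 < u_i ≤ a for all i} of the function ψ(u) = ⟨u − x, g⟩ + (1/τ)·D_h(u, x), where D_h is the Bregman divergence of Burg's entropy, is the point u* with coordinates u*_i = min( x_i/(1 + τ·x_i·g_i), a ). Equivalently, u* is the Euclidean projection onto [0,a]^n of the point whose i-th coordinate is (1/x_i + τ·g_i)^{-1}, i.e., of ∇h*(∇h(x) − τ·g) where ∇h(x)_i = −1/x_i and ∇h*(z)_i = −1/z_i. -/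
/-- On `(0, a]`, the function `u ↦ c * u - log u` is minimized exactly at `min c⁻¹ a`. -/
theorem mul_sub_log_min_lt {a c u : ℝ} (ha : 0 < a) (hc : 0 < c) (hu : 0 < u) (hua : u ≤ a)
    (hne : u ≠ min c⁻¹ a) :
    c * min c⁻¹ a - Real.log (min c⁻¹ a) < c * u - Real.log u := by
  have hs : 0 < min c⁻¹ a := lt_min (inv_pos.mpr hc) ha
  have hslope : 0 ≤ (u - min c⁻¹ a) * (c - (min c⁻¹ a)⁻¹) := by
    rcases le_total c⁻¹ a with h | h
    · simp [min_eq_left h]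
    · rw [min_eq_right h]
      exact mul_nonneg_of_nonpos_of_nonpos (sub_nonpos.mpr hua)
        (sub_nonpos.mpr ((le_inv_comm₀ ha hc).mp h))
  generalize min c⁻¹ a = s at *
  have hlog := Real.log_lt_sub_one_of_pos (div_pos hu hs) (by rwa [Ne, div_eq_one_iff_eq hs.ne'])
  rw [Real.log_div hu.ne' hs.ne'] at hlog
  have hdiv : (u - s) * (c - s⁻¹) = c * u - c * s - (u / s - 1) := by
    field_simp
  linarith

/-- Strict minimality of the clamped mirror update in a single coordinate. -/
theorem burg_prox_coord_lt {a τ x g u : ℝ} (ha : 0 < a) (hτ : 0 < τ) (hx : 0 < x)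
    (hpos : 0 < 1 / x + τ * g) (hu : 0 < u) (hua : u ≤ a)
    (hne : u ≠ min (x / (1 + τ * x * g)) a) :
    (min (x / (1 + τ * x * g)) a - x) * g + 1 / τ *
        (-Real.log (min (x / (1 + τ * x * g)) a) + Real.log x +
          (min (x / (1 + τ * x * g)) a - x) / x) <
      (u - x) * g + 1 / τ * (-Real.log u + Real.log x + (u - x) / x) := by
  have hinv : x / (1 + τ * x * g) = (1 / x + τ * g)⁻¹ := by
    rw [← inv_div]
    congr 1
    field_simp
  rw [hinv] at hne ⊢
  have hlt := mul_sub_log_min_lt ha hpos hu hua hne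
  have hrw (v : ℝ) : (v - x) * g + 1 / τ * (-Real.log v + Real.log x + (v - x) / x) =
      1 / τ * ((1 / x + τ * g) * v - Real.log v) + (1 / τ * (Real.log x - 1) - x * g) := by
    field_simp
    ring
  rw [hrw, hrw]
  gcongr

/-- closed form of one projected Mirror Descent step with Burg's entropy:
the unique minimizer of the Bregman proximal gradient subproblem over the box is the
componentwise clamp of the mirror update. -/
theorem stmt11 {n : ℕ} (a τ : ℝ) (ha : 0 < a) (hτ : 0 < τ)
    (x g : Fin n → ℝ) (hx : ∀ i, 0 < x i)
    (hpos : ∀ i, 0 < 1 / x i + τ * g i) :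
    let ψ : (Fin n → ℝ) → ℝ := fun u =>
      (∑ i, (u i - x i) * g i) +
        (1 / τ) * ∑ i, (-Real.log (u i) + Real.log (x i) + (u i - x i) / x i)
    let ustar : Fin n → ℝ := fun i => min (x i / (1 + τ * x i * g i)) a
    ustar ∈ {u : Fin n → ℝ | ∀ i, 0 < u i ∧ u i ≤ a} ∧
    (∀ u ∈ {u : Fin n → ℝ | ∀ i, 0 < u i ∧ u i ≤ a}, ψ ustar ≤ ψ u) ∧
    (∀ u ∈ {u : Fin n → ℝ | ∀ i, 0 < u i ∧ u i ≤ a}, ψ u = ψ ustar → u = ustar) := by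
  intro ψ ustar
  have hψ (u : Fin n → ℝ) : ψ u = ∑ i, ((u i - x i) * g i +
      1 / τ * (-Real.log (u i) + Real.log (x i) + (u i - x i) / x i)) := by
    rw [Finset.sum_add_distrib, ← Finset.mul_sum]
  have hlt (u : Fin n → ℝ) (hu : ∀ i, 0 < u i ∧ u i ≤ a) (hne : u ≠ ustar) :
      ψ ustar < ψ u := by
    rw [hψ, hψ]
    obtain ⟨j, hj⟩ := Function.ne_iff.mp hne
    refine Finset.sum_lt_sum (fun i _ => ?_) ⟨j, Finset.mem_univ j,
      burg_prox_coord_lt ha hτ (hx j) (hpos j) (hu j).1 (hu j).2 hj⟩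
    by_cases hi : u i = ustar i
    · rw [hi]
    · exact (burg_prox_coord_lt ha hτ (hx i) (hpos i) (hu i).1 (hu i).2 hi).le
  refine ⟨fun i => ⟨lt_min (div_pos (hx i) ?_) ha, min_le_right _ _⟩, fun u hu => ?_,
    fun u hu heq => ?_⟩
  · have h := mul_pos (hx i) (hpos i)
    have hxi := (hx i).ne'
    have hmul : x i * (1 / x i + τ * g i) = 1 + τ * x i * g i := by
      field_simp
    rwa [hmul] at h
  · by_cases h : u = ustar
    · rw [h]
    · exact (hlt u hu h).le
  · by_contra h
    exact (hlt u hu h).ne' heq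
end

section
/- Let a > 0 and let R : ℝⁿ → ℝ be twice continuously differentiable with its Hessian uniformly bounded on the open cube (0,a)ⁿ, i.e., there is M ≥ 0 with ‖∇²R(x)v‖ ≤ M‖v‖ for all x ∈ (0,a)ⁿ and all v ∈ ℝⁿ. Then for every L' ≥ M·a², the function L'·h − R is convex on (0,a)ⁿ, where h is Burg's entropy. -/
theorem ConvexOn.of_forall_segment {E : Type*} [AddCommGroup E] [Module ℝ E] {s : Set E}
    {f : E → ℝ} (hs : Convex ℝ s)
    (h : ∀ x ∈ s, ∀ y ∈ s, ConvexOn ℝ (Set.Icc (0 : ℝ) 1) fun t => f (x + t • (y - x))) :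
    ConvexOn ℝ s f := by
  refine ⟨hs, fun x hx y hy p q hp hq hpq => ?_⟩
  have key := (h x hx y hy).2 (Set.left_mem_Icc.2 zero_le_one)
    (Set.right_mem_Icc.2 zero_le_one) hp hq hpq
  have hcomb : x + q • (y - x) = p • x + q • y := by
    rw [← eq_sub_iff_add_eq] at hpq
    rw [hpq]
    module
  simpa [hcomb] using key

theorem ConvexOn.finset_sum {ι E : Type*} [AddCommGroup E] [Module ℝ E] {s : Set E}
    (hs : Convex ℝ s) (t : Finset ι) {f : ι → E → ℝ} (hf : ∀ i ∈ t, ConvexOn ℝ s (f i)) :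
    ConvexOn ℝ s fun x => ∑ i ∈ t, f i x := by
  classical
  induction t using Finset.induction_on with
  | empty => simpa using convexOn_const (0 : ℝ) hs
  | insert j t hj ih =>
    simp only [Finset.sum_insert hj]
    exact (hf j (t.mem_insert_self j)).add (ih fun i hi => hf i (Finset.mem_insert_of_mem hi))

theorem ContDiff.gradient {F : Type*} [NormedAddCommGroup F] [InnerProductSpace ℝ F]
    [CompleteSpace F] {f : F → ℝ} {m n : WithTop ℕ∞} (hf : ContDiff ℝ n f) (hmn : m + 1 ≤ n) :
    ContDiff ℝ m (gradient f) :=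
  (InnerProductSpace.toDual ℝ F).symm.contDiff.comp (hf.fderiv_right hmn)

/-- If the Hessian of `f` is bounded by `M` in operator norm on a convex set, then
`M / 2 * ‖x‖ ^ 2 - f x` is convex there. -/
theorem convexOn_norm_sq_sub_of_norm_hessian_le {F : Type*} [NormedAddCommGroup F]
    [InnerProductSpace ℝ F] [CompleteSpace F] {s : Set F} (hs : Convex ℝ s) {f : F → ℝ}
    (hf : ContDiff ℝ 2 f) {M : ℝ}
    (hM : ∀ x ∈ s, ∀ v : F, ‖fderiv ℝ (gradient f) x v‖ ≤ M * ‖v‖) :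
    ConvexOn ℝ s fun x => M / 2 * ‖x‖ ^ 2 - f x := by
  refine .of_forall_segment hs fun x hx y hy => ?_
  set v := y - x
  have hline (t : ℝ) : HasDerivAt (fun t : ℝ => x + t • v) v t := by
    simpa using ((hasDerivAt_id t).smul_const v).const_add x
  have hgrad (t : ℝ) : HasDerivAt (fun t : ℝ => gradient f (x + t • v))
      (fderiv ℝ (gradient f) (x + t • v) v) t := by
    have h := ((hf.gradient (m := 1) (by norm_num)).differentiable one_ne_zero
      (x + t • v)).hasFDerivAt
    exact h.comp_hasDerivAt t (hline t)
  have hd (t : ℝ) : HasDerivAt (fun t : ℝ => M / 2 * ‖x + t • v‖ ^ 2 - f (x + t • v))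
      (M * inner ℝ (x + t • v) v - inner ℝ (gradient f (x + t • v)) v) t := by
    have h1 := (hline t).norm_sq.const_mul (M / 2)
    have h2 := ((hf.differentiable two_ne_zero (x + t • v)).hasFDerivAt).comp_hasDerivAt t (hline t)
    rw [inner_gradient_left]
    exact (h1.sub h2).congr_deriv (by ring)
  have hdd (t : ℝ) : HasDerivAt
      (fun t : ℝ => M * inner ℝ (x + t • v) v - inner ℝ (gradient f (x + t • v)) v)
      (M * inner ℝ v v - inner ℝ (fderiv ℝ (gradient f) (x + t • v) v) v) t := by
    have h1 := ((hline t).inner ℝ (hasDerivAt_const t v)).const_mul M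
    have h2 := (hgrad t).inner ℝ (hasDerivAt_const t v)
    exact (h1.sub h2).congr_deriv (by simp)
  refine convexOn_of_hasDerivWithinAt2_nonneg (convex_Icc 0 1)
    (fun t _ => (hd t).continuousAt.continuousWithinAt) (fun t _ => (hd t).hasDerivWithinAt)
    (fun t _ => (hdd t).hasDerivWithinAt) fun t ht => ?_
  have hmem : x + t • v ∈ s := hs.add_smul_sub_mem hx hy (interior_subset ht)
  have hle := (real_inner_le_norm (fderiv ℝ (gradient f) (x + t • v) v) v).trans
    (mul_le_mul_of_nonneg_right (hM _ hmem v) (norm_nonneg v))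
  rw [real_inner_self_eq_norm_sq]
  linarith

theorem convexOn_neg_log_sub_sq {a M L : ℝ} (hM : 0 ≤ M) (hL : M * a ^ 2 ≤ L) :
    ConvexOn ℝ (Set.Ioo 0 a) fun x => L * -Real.log x - M / 2 * x ^ 2 := by
  have hd {x : ℝ} (hx : x ∈ Set.Ioo 0 a) :
      HasDerivAt (fun x => L * -Real.log x - M / 2 * x ^ 2) (L * -x⁻¹ - M * x) x :=
    (((Real.hasDerivAt_log hx.1.ne').neg.const_mul L).sub
      ((hasDerivAt_pow 2 x).const_mul (M / 2))).congr_deriv (by norm_num; ring)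
  have hdd {x : ℝ} (hx : x ∈ Set.Ioo 0 a) :
      HasDerivAt (fun x => L * -x⁻¹ - M * x) (L / x ^ 2 - M) x :=
    (((hasDerivAt_inv hx.1.ne').neg.const_mul L).sub
      ((hasDerivAt_id x).const_mul M)).congr_deriv (by ring)
  refine convexOn_of_hasDerivWithinAt2_nonneg (convex_Ioo 0 a)
    (fun x hx => (hd hx).continuousAt.continuousWithinAt)
    (fun x hx => (hd (interior_subset hx)).hasDerivWithinAt)
    (fun x hx => (hdd (interior_subset hx)).hasDerivWithinAt) fun x hx => ?_
  obtain ⟨hx0, hxa⟩ := interior_subset hx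
  rw [sub_nonneg, le_div_iff₀ (by positivity)]
  exact (by gcongr : M * x ^ 2 ≤ M * a ^ 2).trans hL

/-- if `R` is C² with Hessian bounded by `M` (in operator norm) on the open
cube `(0,a)ⁿ`, then `L'·h − R` is convex there for every `L' ≥ M·a²`, where `h` is
Burg's entropy. -/
theorem stmt13 {n : ℕ} (a : ℝ) (ha : 0 < a)
    (R : EuclideanSpace ℝ (Fin n) → ℝ) (hR : ContDiff ℝ 2 R)
    (M : ℝ) (hM : 0 ≤ M)
    (hHess : ∀ x : EuclideanSpace ℝ (Fin n), (∀ i, 0 < x i ∧ x i < a) →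
      ∀ v : EuclideanSpace ℝ (Fin n), ‖fderiv ℝ (gradient R) x v‖ ≤ M * ‖v‖) :
    ∀ L' : ℝ, M * a ^ 2 ≤ L' →
      ConvexOn ℝ {x : EuclideanSpace ℝ (Fin n) | ∀ i, 0 < x i ∧ x i < a}
        (fun x => L' * (-∑ i, Real.log (x i)) - R x) := by
  intro L' hL
  set s : Set (EuclideanSpace ℝ (Fin n)) := {x | ∀ i, 0 < x i ∧ x i < a}
  have hcoord (i : Fin n) : Convex ℝ {x : EuclideanSpace ℝ (Fin n) | x i ∈ Set.Ioo 0 a} :=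
    (convex_Ioo 0 a).linear_preimage (EuclideanSpace.proj (𝕜 := ℝ) i).toLinearMap
  have hs : Convex ℝ s := by
    have h := convex_iInter hcoord
    rwa [← Set.ofPred_forall] at h
  have hburg : ConvexOn ℝ s fun x => ∑ i, (L' * -Real.log (x i) - M / 2 * x i ^ 2) :=
    .finset_sum hs _ fun i _ => ((convexOn_neg_log_sub_sq hM hL).comp_linearMap
      (EuclideanSpace.proj (𝕜 := ℝ) i).toLinearMap).subset (fun x hx => hx i) hs
  refine (hburg.add (convexOn_norm_sq_sub_of_norm_hessian_le hs hR hHess)).congr fun x _ => ?_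
  simp only [Pi.add_apply, EuclideanSpace.real_norm_sq_eq, Finset.sum_sub_distrib,
    ← Finset.mul_sum, Finset.sum_neg_distrib]
  ring
end

section
/- Let h be Burg's entropy on ℝⁿ_{>0}, let F : ℝⁿ_{>0} → ℝ be differentiable with L·h − F convex on ℝⁿ_{>0} for some L > 0, let a > 0, let τ ∈ (0, 1/L), and let x ∈ ℝⁿ with 0 < x_i ≤ a for all i. Let u* be a minimizer over {u ∈ ℝⁿ : 0 < u_i ≤ a for all i} of the function u ↦ ⟨u − x, ∇F(x)⟩ + (1/τ)·D_h(u, x). Then F(u*) + (1/τ − L)·D_h(u*, x) ≤ F(x); in particular F(u*) ≤ F(x), with strict decrease unless u* = x. -/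
/-- The gradient inequality for a convex function along a segment, in terms of the directional
derivative at one end. -/
lemma ConvexOn.add_le_of_hasDerivAt_lineMap {E : Type*} [AddCommGroup E] [Module ℝ E]
    {s : Set E} {f : E → ℝ} (hf : ConvexOn ℝ s f) {x y : E} (hx : x ∈ s) (hy : y ∈ s) {d : ℝ}
    (hd : HasDerivAt (fun t : ℝ => f (AffineMap.lineMap x y t)) d 0) :
    f x + d ≤ f y := by
  have hg := hf.comp_affineMap (AffineMap.lineMap x y : ℝ →ᵃ[ℝ] E)
  have h := hg.le_slope_of_hasDerivAt (x := 0) (y := 1) (by simpa using hx) (by simpa using hy)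
    one_pos hd
  simp only [slope_def_field, Function.comp_apply, AffineMap.lineMap_apply_one,
    AffineMap.lineMap_apply_zero, sub_zero, div_one] at h
  linarith

/-- The one-dimensional Bregman divergence of `-log` is nonnegative. -/
lemma burg_term_nonneg {u x : ℝ} (hu : 0 < u) (hx : 0 < x) :
    0 ≤ -Real.log u + Real.log x + (u - x) / x := by
  have h := Real.log_le_sub_one_of_pos (div_pos hu hx)
  rw [Real.log_div hu.ne' hx.ne'] at h
  rw [sub_div, div_self hx.ne']
  linarith

/-- The one-dimensional Bregman divergence of `-log` is positive off the diagonal. -/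
lemma burg_term_pos {u x : ℝ} (hu : 0 < u) (hx : 0 < x) (hne : u ≠ x) :
    0 < -Real.log u + Real.log x + (u - x) / x := by
  have h := Real.log_lt_sub_one_of_pos (div_pos hu hx) (by rwa [Ne, div_eq_one_iff_eq hx.ne'])
  rw [Real.log_div hu.ne' hx.ne'] at h
  rw [sub_div, div_self hx.ne']
  linarith

/-- sufficient-decrease property of one projected Mirror Descent step under
the relative smoothness (NoLip) condition for `(F, h)` with `h` Burg's entropy. -/
theorem stmt16 {n : ℕ} (L a τ : ℝ) (hL : 0 < L) (ha : 0 < a)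
    (hτ0 : 0 < τ) (hτL : τ < 1 / L)
    (F : EuclideanSpace ℝ (Fin n) → ℝ)
    (F' : EuclideanSpace ℝ (Fin n) → EuclideanSpace ℝ (Fin n))
    (hF : ∀ x : EuclideanSpace ℝ (Fin n), (∀ i, 0 < x i) → HasGradientAt F (F' x) x)
    (hNoLip : ConvexOn ℝ {x : EuclideanSpace ℝ (Fin n) | ∀ i, 0 < x i}
      (fun x => L * (-∑ i, Real.log (x i)) - F x))
    (x : EuclideanSpace ℝ (Fin n)) (hx : ∀ i, 0 < x i ∧ x i ≤ a)
    (ustar : EuclideanSpace ℝ (Fin n))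
    (hustar : ∀ i, 0 < ustar i ∧ ustar i ≤ a)
    (hmin : ∀ u : EuclideanSpace ℝ (Fin n), (∀ i, 0 < u i ∧ u i ≤ a) →
      (∑ i, (ustar i - x i) * F' x i) +
          (1 / τ) * ∑ i, (-Real.log (ustar i) + Real.log (x i) + (ustar i - x i) / x i)
        ≤ (∑ i, (u i - x i) * F' x i) +
          (1 / τ) * ∑ i, (-Real.log (u i) + Real.log (x i) + (u i - x i) / x i)) :
    F ustar + (1 / τ - L) *
        (∑ i, (-Real.log (ustar i) + Real.log (x i) + (ustar i - x i) / x i)) ≤ F x ∧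
    F ustar ≤ F x ∧ (ustar ≠ x → F ustar < F x) := by
  have hline : HasDerivAt (fun t : ℝ => (AffineMap.lineMap x ustar t : EuclideanSpace ℝ (Fin n)))
      (ustar - x) 0 := AffineMap.hasDerivAt_lineMap
  have hlog : HasDerivAt
      (fun t : ℝ => ∑ i, Real.log ((AffineMap.lineMap x ustar t : EuclideanSpace ℝ (Fin n)) i))
      (∑ i, (ustar i - x i) / x i) 0 := by
    refine HasDerivAt.fun_sum fun i _ => ?_
    have hi : HasDerivAt
        (fun t : ℝ => (AffineMap.lineMap x ustar t : EuclideanSpace ℝ (Fin n)) i)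
        (ustar i - x i) 0 :=
      (EuclideanSpace.proj (𝕜 := ℝ) i).hasFDerivAt.comp_hasDerivAt 0 hline
    simpa using hi.log (by simpa using (hx i).1.ne')
  have hFline : HasDerivAt (fun t : ℝ => F (AffineMap.lineMap x ustar t))
      (∑ i, (ustar i - x i) * F' x i) 0 := by
    have hFx : HasFDerivAt F (InnerProductSpace.toDual ℝ _ (F' x))
        (AffineMap.lineMap x ustar (0 : ℝ)) := by
      simpa using (hF x fun i => (hx i).1).hasFDerivAt
    simpa [PiLp.inner_apply, Function.comp_def] using hFx.comp_hasDerivAt 0 hline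
  have hgrad := hNoLip.add_le_of_hasDerivAt_lineMap (fun i => (hx i).1) (fun i => (hustar i).1)
    ((hlog.neg.const_mul L).sub hFline)
  have hdecr := hmin x hx
  simp only [sub_self, zero_mul, zero_div, neg_add_cancel, add_zero, Finset.sum_const_zero,
    mul_zero] at hdecr
  have hsum : ∑ i, (-Real.log (ustar i) + Real.log (x i) + (ustar i - x i) / x i) =
      -∑ i, Real.log (ustar i) + ∑ i, Real.log (x i) + ∑ i, (ustar i - x i) / x i := by
    simp only [Finset.sum_add_distrib, Finset.sum_neg_distrib]
  have hmain : F ustar + (1 / τ - L) *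
      (∑ i, (-Real.log (ustar i) + Real.log (x i) + (ustar i - x i) / x i)) ≤ F x := by
    rw [hsum] at hdecr ⊢
    linarith
  have hgap : 0 < 1 / τ - L := sub_pos.2 ((lt_one_div hτ0 hL).1 hτL)
  have hnonneg := fun i => burg_term_nonneg (hustar i).1 (hx i).1
  refine ⟨hmain, ?_, fun hne => ?_⟩
  · have := mul_nonneg hgap.le (Finset.sum_nonneg fun i (_ : i ∈ Finset.univ) => hnonneg i)
    linarith
  · obtain ⟨i, hi⟩ : ∃ i, ustar i ≠ x i := by
      by_contra! h
      exact hne (PiLp.ext h)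
    have := mul_pos hgap (Finset.sum_pos' (fun i _ => hnonneg i)
      ⟨i, Finset.mem_univ i, burg_term_pos (hustar i).1 (hx i).1 hi⟩)
    linarith
end
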